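/- Let G be a finite simple graph, let k ≥ 2 be an integer, and let S be a minimum k-forcing set of G (i.e., S is a k-forcing set with |S| = F_k(G)). If w ∈ V - S and 2 ≤ deg(w) < k, then w has at most one neighbor in S. -/

import Mathlib

open Finset SimpleGraph

/-- One round of the `k`-forcing color change rule: to the currently colored set `C` we add
every vertex `w` having a colored neighbor `v` with at most `k` non-colored neighbors. -/
def kForceStep {V : Type*} [Fintype V] [DecidableEq V] (G : SimpleGraph V)
    [DecidableRel G.Adj] (k : ℕ) (C : Finset V) : Finset V :=
  C ∪ Finset.univ.filter (fun w =>
    ∃ v ∈ C, G.Adj v w ∧ ((G.neighborFinset v) \ C).card ≤ k)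

/-- `S` is a `k`-forcing set: iterating the color change rule starting from `S`
eventually colors all vertices. -/
def IsKForcingSet {V : Type*} [Fintype V] [DecidableEq V] (G : SimpleGraph V)
    [DecidableRel G.Adj] (k : ℕ) (S : Finset V) : Prop :=
  (kForceStep G k)^[Fintype.card V] S = Finset.univ

/-- The `k`-forcing number: the minimum cardinality of a `k`-forcing set. -/
noncomputable def kForcingNumber {V : Type*} [Fintype V] [DecidableEq V] (G : SimpleGraph V)
    [DecidableRel G.Adj] (k : ℕ) : ℕ :=
  sInf {m | ∃ S : Finset V, IsKForcingSet G k S ∧ S.card = m}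

section kForcing

variable {V : Type*} [Fintype V] [DecidableEq V] (G : SimpleGraph V) [DecidableRel G.Adj] (k : ℕ)

theorem subset_kForceStep (C : Finset V) : C ⊆ kForceStep G k C :=
  Finset.subset_union_left

theorem kForceStep_mono : Monotone (kForceStep G k) := by
  intro C D hCD x hx
  simp only [kForceStep, Finset.mem_union, Finset.mem_filter, Finset.mem_univ, true_and] at hx ⊢
  rcases hx with hx | ⟨v, hv, hadj, hcard⟩
  · exact Or.inl (hCD hx)
  · exact Or.inr ⟨v, hCD hv, hadj,
      (Finset.card_le_card (Finset.sdiff_subset_sdiff subset_rfl hCD)).trans hcard⟩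

theorem neighborFinset_subset_kForceStep {C : Finset V} {v : V} (hv : v ∈ C)
    (hdeg : G.degree v ≤ k) : G.neighborFinset v ⊆ kForceStep G k C := by
  intro x hx
  refine Finset.mem_union_right _ (Finset.mem_filter.mpr ⟨Finset.mem_univ x, v, hv, ?_, ?_⟩)
  · simpa using hx
  · exact (Finset.card_le_card Finset.sdiff_subset).trans hdeg

theorem le_card_iterate_kForceStep_or_fixed (S : Finset V) (n : ℕ) :
    n ≤ ((kForceStep G k)^[n] S).card ∨
      kForceStep G k ((kForceStep G k)^[n] S) = (kForceStep G k)^[n] S := by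
  induction n with
  | zero => exact Or.inl (Nat.zero_le _)
  | succ n ih =>
    rw [Function.iterate_succ_apply']
    by_cases hfix : kForceStep G k ((kForceStep G k)^[n] S) = (kForceStep G k)^[n] S
    · exact Or.inr (by rw [hfix, hfix])
    · refine Or.inl ?_
      have hlt := Finset.card_lt_card
        ((subset_kForceStep G k ((kForceStep G k)^[n] S)).ssubset_of_ne (Ne.symm hfix))
      have hn := ih.resolve_right hfix
      omega

theorem isKForcingSet_of_subset_kForceStep {S T : Finset V} (hS : IsKForcingSet G k S)
    (hST : S ⊆ kForceStep G k T) : IsKForcingSet G k T := by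
  unfold IsKForcingSet at *
  rcases le_card_iterate_kForceStep_or_fixed G k T (Fintype.card V) with h | h
  · exact (Finset.card_eq_iff_eq_univ _).mp (le_antisymm (Finset.card_le_univ _) h)
  · rw [← h, ← Function.iterate_succ_apply' (kForceStep G k), Function.iterate_succ_apply]
    have hsub := (kForceStep_mono G k).iterate (Fintype.card V) hST
    rw [hS] at hsub
    exact Finset.univ_subset_iff.mp hsub

theorem kForcingNumber_le_card {S : Finset V} (hS : IsKForcingSet G k S) :
    kForcingNumber G k ≤ S.card :=
  Nat.sInf_le ⟨S, hS, rfl⟩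

end kForcing

/-- Lemma 3: Let `k ≥ 2` and `S` a minimum `k`-forcing set of `G`.
If `w ∈ V - S` and `2 ≤ deg w < k`, then `w` has at most one neighbor in `S`. -/
theorem min_kForcingSet_low_degree_vertex {V : Type*} [Fintype V] [DecidableEq V]
    (G : SimpleGraph V) [DecidableRel G.Adj]
    (k : ℕ) (hk : 2 ≤ k) (S : Finset V) (hS : IsKForcingSet G k S)
    (hmin : S.card = kForcingNumber G k)
    (w : V) (hw : w ∉ S) (hdeg2 : 2 ≤ G.degree w) (hdegk : G.degree w < k) :
    ((G.neighborFinset w) ∩ S).card ≤ 1 := by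
  have hT : IsKForcingSet G k (insert w (S \ G.neighborFinset w)) := by
    refine isKForcingSet_of_subset_kForceStep G k hS fun x hx => ?_
    by_cases hxw : x ∈ G.neighborFinset w
    · exact neighborFinset_subset_kForceStep G k (Finset.mem_insert_self _ _) hdegk.le hxw
    · exact subset_kForceStep G k _
        (Finset.mem_insert_of_mem (Finset.mem_sdiff.mpr ⟨hx, hxw⟩))
  have hle := kForcingNumber_le_card G k hT
  have hins := Finset.card_insert_le w (S \ G.neighborFinset w)
  have hsplit := Finset.card_sdiff_add_card_inter S (G.neighborFinset w)
  rw [Finset.inter_comm] at hsplit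
  omega
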